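/- Fix n : ℕ and functions μ : Fin n → ℝ and σ : Fin n → ℝ with σ j > 0 for all j. The Kullback–Leibler divergence between the product measure ⊗_{j} gaussianReal (μ j) ((σ j)²) on (Fin n → ℝ) and the product of standard Gaussians ⊗_{j} gaussianReal 0 1 equals (1/2) * ∑_{j} ((μ j)² + (σ j)² − Real.log ((σ j)²) − 1). -/

import Mathlib

open MeasureTheory ProbabilityTheory
open scoped Classical

/-- Kullback–Leibler divergence `KL(μ‖ν) = ∫ log (dμ/dν) dμ`, valued in `[0, ∞]`
(as in Mathlib's `klDiv`): it is `⊤` unless `μ ≪ ν` and the log-likelihood ratio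
is integrable. -/

noncomputable def klDiv {α : Type*} [MeasurableSpace α] (μ ν : Measure α) : ENNReal :=
  if μ ≪ ν ∧ Integrable (llr μ ν) μ then ENNReal.ofReal (∫ x, llr μ ν x ∂μ) else ⊤

open scoped ENNReal NNReal

section Pi

variable {ι : Type*} [Fintype ι] {X : ι → Type*} [∀ i, MeasurableSpace (X i)]
  {μ ν : ∀ i, Measure (X i)} [∀ i, IsProbabilityMeasure (μ i)] [∀ i, IsProbabilityMeasure (ν i)]

/-- Tonelli's theorem for a product of functions of separate coordinates. -/
lemma lintegral_pi_prod {f : ∀ i, X i → ℝ≥0∞} (hf : ∀ i, Measurable (f i)) :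
    ∫⁻ x, ∏ i, f i (x i) ∂Measure.pi ν = ∏ i, ∫⁻ x, f i x ∂ν i := by
  have hindep : iIndepFun (fun i (x : ∀ i, X i) ↦ f i (x i)) (Measure.pi ν) :=
    iIndepFun_pi fun i ↦ (hf i).aemeasurable
  rw [lintegral_prod_eq_prod_lintegral_of_indepFun Finset.univ _ hindep
    fun i ↦ (hf i).comp (measurable_pi_apply i)]
  exact Finset.prod_congr rfl fun i _ ↦ (measurePreserving_eval ν i).lintegral_comp (hf i)

/-- A product of absolutely continuous measures has the product of the densities as density. -/
lemma pi_eq_withDensity_prod_rnDeriv (h : ∀ i, μ i ≪ ν i) :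
    Measure.pi μ = (Measure.pi ν).withDensity fun x ↦ ∏ i, (μ i).rnDeriv (ν i) (x i) := by
  refine Measure.pi_eq fun s hs ↦ ?_
  have hind (x : ∀ i, X i) :
      (Set.univ.pi s).indicator (fun x ↦ ∏ i, (μ i).rnDeriv (ν i) (x i)) x
        = ∏ i, (s i).indicator ((μ i).rnDeriv (ν i)) (x i) := by
    by_cases hx : x ∈ Set.univ.pi s
    · rw [Set.indicator_of_mem hx]
      exact Finset.prod_congr rfl fun i _ ↦ (Set.indicator_of_mem (hx i trivial) _).symm
    · rw [Set.indicator_of_notMem hx]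
      obtain ⟨i, hi⟩ : ∃ i, x i ∉ s i := by simpa [Set.mem_pi] using hx
      exact (Finset.prod_eq_zero (Finset.mem_univ i) (Set.indicator_of_notMem hi _)).symm
  have hs' : MeasurableSet (Set.univ.pi s) := MeasurableSet.univ_pi hs
  rw [withDensity_apply _ hs', ← lintegral_indicator hs', lintegral_congr hind,
    lintegral_pi_prod fun i ↦ (Measure.measurable_rnDeriv _ _).indicator (hs i)]
  refine Finset.prod_congr rfl fun i _ ↦ ?_
  rw [lintegral_indicator (hs i), Measure.setLIntegral_rnDeriv (h i)]

lemma pi_absolutelyContinuous (h : ∀ i, μ i ≪ ν i) : Measure.pi μ ≪ Measure.pi ν := by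
  rw [pi_eq_withDensity_prod_rnDeriv h]
  exact withDensity_absolutelyContinuous _ _

/-- The log-likelihood ratio of product measures is the sum of the coordinate ones. -/
lemma llr_pi (h : ∀ i, μ i ≪ ν i) :
    llr (Measure.pi μ) (Measure.pi ν) =ᵐ[Measure.pi μ] fun x ↦ ∑ i, llr (μ i) (ν i) (x i) := by
  have hac := pi_absolutelyContinuous h
  have hrn : (Measure.pi μ).rnDeriv (Measure.pi ν) =ᵐ[Measure.pi μ]
      fun x ↦ ∏ i, (μ i).rnDeriv (ν i) (x i) := by
    refine hac.ae_eq ?_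
    conv_lhs => rw [pi_eq_withDensity_prod_rnDeriv h]
    exact Measure.rnDeriv_withDensity _ (by fun_prop)
  have hpos : ∀ᵐ x ∂Measure.pi μ, ∀ i, ((μ i).rnDeriv (ν i) (x i)).toReal ≠ 0 := by
    refine ae_all_iff.2 fun i ↦ (Measure.quasiMeasurePreserving_eval μ i).ae
      (p := fun y ↦ ((μ i).rnDeriv (ν i) y).toReal ≠ 0) ?_
    filter_upwards [Measure.rnDeriv_pos (h i), (h i) (Measure.rnDeriv_ne_top (μ i) (ν i))]
      with x hx hx' using (ENNReal.toReal_pos hx.ne' hx').ne'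
  filter_upwards [hrn, hpos] with x hx hx'
  rw [llr, hx, ENNReal.toReal_prod, Real.log_prod fun i _ ↦ hx' i]
  rfl

/-- **Additivity of the Kullback–Leibler divergence** over independent coordinates. -/
lemma klDiv_pi (h : ∀ i, μ i ≪ ν i) (hint : ∀ i, Integrable (llr (μ i) (ν i)) (μ i)) :
    klDiv (Measure.pi μ) (Measure.pi ν)
      = ENNReal.ofReal (∑ i, ∫ x, llr (μ i) (ν i) x ∂μ i) := by
  have hint' (i : ι) : Integrable (fun x : ∀ i, X i ↦ llr (μ i) (ν i) (x i)) (Measure.pi μ) :=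
    integrable_comp_eval (hint i)
  have hllr := llr_pi h
  rw [klDiv, if_pos ⟨pi_absolutelyContinuous h,
    (integrable_congr hllr).2 (integrable_finsetSum _ fun i _ ↦ hint' i)⟩,
    integral_congr_ae hllr, integral_finsetSum _ fun i _ ↦ hint' i]
  congr 1
  exact Finset.sum_congr rfl fun i _ ↦ integral_comp_eval (hint i).aestronglyMeasurable

end Pi

section Gaussian

lemma gaussianReal_absolutelyContinuous_gaussianReal (m m' : ℝ) {v v' : ℝ≥0} (hv : v ≠ 0)
    (hv' : v' ≠ 0) : gaussianReal m v ≪ gaussianReal m' v' :=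
  (gaussianReal_absolutelyContinuous m hv).trans (gaussianReal_absolutelyContinuous' m' hv')

lemma log_gaussianPDFReal (m : ℝ) {v : ℝ≥0} (hv : v ≠ 0) (x : ℝ) :
    Real.log (gaussianPDFReal m v x)
      = -(Real.log (2 * Real.pi) + Real.log v) / 2 - (x - m) ^ 2 / (2 * v) := by
  have hv' : (0 : ℝ) < v := by positivity
  rw [gaussianPDFReal, Real.log_mul (by positivity) (Real.exp_ne_zero _), Real.log_exp,
    Real.log_inv, Real.log_sqrt (by positivity), Real.log_mul (by positivity) hv'.ne']
  ring

lemma llr_gaussianReal_standard (m : ℝ) {v : ℝ≥0} (hv : v ≠ 0) :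
    llr (gaussianReal m v) (gaussianReal 0 1) =ᵐ[gaussianReal m v]
      fun x ↦ x ^ 2 / 2 - (x - m) ^ 2 / (2 * v) - Real.log v / 2 := by
  have hac := gaussianReal_absolutelyContinuous m hv
  have hac₁ := gaussianReal_absolutelyContinuous 0 one_ne_zero
  filter_upwards [(gaussianReal_absolutelyContinuous_gaussianReal m 0 hv one_ne_zero)
      (Measure.rnDeriv_eq_div hac hac₁),
    hac (rnDeriv_gaussianReal m v), hac (rnDeriv_gaussianReal 0 1)] with x hx hx₁ hx₂
  rw [llr, hx, hx₁, hx₂, ENNReal.toReal_div, toReal_gaussianPDF, toReal_gaussianPDF,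
    Real.log_div (gaussianPDFReal_pos _ _ _ hv).ne' (gaussianPDFReal_pos _ _ _ one_ne_zero).ne',
    log_gaussianPDFReal _ hv, log_gaussianPDFReal _ one_ne_zero]
  simp
  ring

lemma integrable_sub_sq_gaussianReal (m c : ℝ) (v : ℝ≥0) :
    Integrable (fun x ↦ (x - c) ^ 2) (gaussianReal m v) :=
  ((memLp_id_gaussianReal 2).sub (memLp_const c)).integrable_sq

lemma integral_sub_mean_sq_gaussianReal (m : ℝ) (v : ℝ≥0) :
    ∫ x, (x - m) ^ 2 ∂gaussianReal m v = v := by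
  have h := variance_fun_id_gaussianReal (μ := m) (v := v)
  rwa [variance_eq_integral (by fun_prop), integral_id_gaussianReal] at h

lemma integral_sq_gaussianReal (m : ℝ) (v : ℝ≥0) :
    ∫ x, x ^ 2 ∂gaussianReal m v = m ^ 2 + v := by
  have h := variance_eq_sub (memLp_id_gaussianReal (μ := m) (v := v) 2)
  simp only [variance_id_gaussianReal, Pi.pow_apply, id_eq, integral_id_gaussianReal] at h
  linarith

lemma integrable_llr_gaussianReal_standard (m : ℝ) {v : ℝ≥0} (hv : v ≠ 0) :
    Integrable (llr (gaussianReal m v) (gaussianReal 0 1)) (gaussianReal m v) := by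
  rw [integrable_congr (llr_gaussianReal_standard m hv)]
  have h := integrable_sub_sq_gaussianReal m 0 v
  simp only [sub_zero] at h
  exact ((h.div_const _).sub ((integrable_sub_sq_gaussianReal m m v).div_const _)).sub
    (integrable_const _)

lemma integral_llr_gaussianReal_standard (m : ℝ) {v : ℝ≥0} (hv : v ≠ 0) :
    ∫ x, llr (gaussianReal m v) (gaussianReal 0 1) x ∂gaussianReal m v
      = (1 / 2) * (m ^ 2 + v - Real.log v - 1) := by
  have h := integrable_sub_sq_gaussianReal m 0 v
  simp only [sub_zero] at h
  have h' := (integrable_sub_sq_gaussianReal m m v).div_const (2 * v)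
  have h_sub : Integrable (fun x ↦ x ^ 2 / 2 - (x - m) ^ 2 / (2 * v)) (gaussianReal m v) :=
    (h.div_const 2).sub h'
  rw [integral_congr_ae (llr_gaussianReal_standard m hv),
    integral_sub h_sub (integrable_const _),
    integral_sub (h.div_const _) h', integral_div, integral_div, integral_sq_gaussianReal,
    integral_sub_mean_sq_gaussianReal]
  have hv' : (v : ℝ) ≠ 0 := by exact_mod_cast hv
  simp only [integral_const, probReal_univ, smul_eq_mul, one_mul]
  field_simp
  ring

lemma klDiv_pi_gaussianReal_standard_of_variance {ι : Type*} [Fintype ι] (m : ι → ℝ)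
    {v : ι → ℝ≥0} (hv : ∀ j, v j ≠ 0) :
    klDiv (Measure.pi fun j ↦ gaussianReal (m j) (v j)) (Measure.pi fun _ ↦ gaussianReal 0 1)
      = ENNReal.ofReal ((1 / 2) * ∑ j, ((m j) ^ 2 + v j - Real.log (v j) - 1)) := by
  rw [klDiv_pi
      (fun j ↦ gaussianReal_absolutelyContinuous_gaussianReal (m j) 0 (hv j) one_ne_zero)
      fun j ↦ integrable_llr_gaussianReal_standard (m j) (hv j), Finset.mul_sum]
  congr 1
  exact Finset.sum_congr rfl fun j _ ↦ integral_llr_gaussianReal_standard (m j) (hv j)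

end Gaussian

/-- **KL divergence between a diagonal Gaussian vector and the standard Gaussian
vector.** For independent coordinates,
`KL(⊗ⱼ 𝒩(μⱼ, σⱼ²) ‖ ⊗ⱼ 𝒩(0, 1)) = ½ ∑ⱼ (μⱼ² + σⱼ² − log σⱼ² − 1)`. -/
theorem klDiv_pi_gaussianReal_standard (n : ℕ) (μ : Fin n → ℝ) (σ : Fin n → ℝ)
    (hσ : ∀ j, 0 < σ j) :
    klDiv (Measure.pi fun j => gaussianReal (μ j) ⟨(σ j) ^ 2, sq_nonneg (σ j)⟩)
        (Measure.pi fun _ => gaussianReal 0 1)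
      = ENNReal.ofReal
          ((1 / 2) * ∑ j, ((μ j) ^ 2 + (σ j) ^ 2 - Real.log ((σ j) ^ 2) - 1)) := by
  exact klDiv_pi_gaussianReal_standard_of_variance μ fun j h ↦
    (pow_pos (hσ j) 2).ne' (congrArg NNReal.toReal h)
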